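/- arXiv:2403.06653 — 2 statements merged into one kernel-verified Lean document; each statement's English description precedes it below -/
import Mathlib

section
/- Let E be a real inner product space and F : E → ℝ a differentiable function whose gradient ∇F is L-Lipschitz with L > 0. Then for every x ∈ E and every error vector e ∈ E, the point x' = x - (1/L)·(∇F(x) - e) satisfies F(x') ≤ F(x) - (1/(2L))·‖∇F(x)‖² + (1/(2L))·‖e‖². -/
open scoped InnerProductSpace

/-- The classical descent lemma (quadratic upper bound). -/
theorem quadratic_upper_bound
    {E : Type*} [NormedAddCommGroup E] [InnerProductSpace ℝ E] [CompleteSpace E]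
    (F : E → ℝ) (F' : E → E) (L : ℝ)
    (hdiff : ∀ x, HasGradientAt F (F' x) x)
    (hlip : ∀ x y, ‖F' x - F' y‖ ≤ L * ‖x - y‖)
    (x d : E) :
    F (x + d) ≤ F x + inner ℝ (F' x) d + L / 2 * ‖d‖ ^ 2 := by
  have hphi : ∀ t : ℝ, HasDerivAt (fun t : ℝ => F (x + t • d)) (inner ℝ (F' (x + t • d)) d) t := by
    intro t
    have h1 : HasDerivAt (fun t : ℝ => x + t • d) d t := by
      simpa using ((hasDerivAt_id t).smul_const d).const_add x
    have h2 := (hdiff (x + t • d)).hasFDerivAt.comp_hasDerivAt t h1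
    simpa [Function.comp_def] using h2
  have hB : ∀ t : ℝ, HasDerivAt
      (fun t : ℝ => F x + t * inner ℝ (F' x) d + L / 2 * ‖d‖ ^ 2 * t ^ 2)
      (inner ℝ (F' x) d + L * t * ‖d‖ ^ 2) t := by
    intro t
    have h := (((hasDerivAt_id t).mul_const (inner ℝ (F' x) d)).const_add (F x)).add
      (((hasDerivAt_id t).pow 2).const_mul (L / 2 * ‖d‖ ^ 2))
    refine h.congr_deriv ?_
    simp
    ring
  have key := image_le_of_deriv_right_le_deriv_boundary (a := 0) (b := 1)
    (f := fun t : ℝ => F (x + t • d)) (f' := fun t : ℝ => inner ℝ (F' (x + t • d)) d)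
    (fun t _ => (hphi t).continuousAt.continuousWithinAt)
    (fun t _ => (hphi t).hasDerivWithinAt)
    (B := fun t : ℝ => F x + t * inner ℝ (F' x) d + L / 2 * ‖d‖ ^ 2 * t ^ 2)
    (B' := fun t : ℝ => inner ℝ (F' x) d + L * t * ‖d‖ ^ 2)
    (by simp)
    (fun t _ => (hB t).continuousAt.continuousWithinAt)
    (fun t _ => (hB t).hasDerivWithinAt)
    (by
      intro t ht
      have h1 : inner ℝ (F' (x + t • d) - F' x) d ≤ ‖F' (x + t • d) - F' x‖ * ‖d‖ :=
        real_inner_le_norm _ _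
      have h2 := hlip (x + t • d) x
      rw [add_sub_cancel_left, norm_smul, Real.norm_of_nonneg ht.1] at h2
      have h3 := mul_le_mul_of_nonneg_right h2 (norm_nonneg d)
      rw [inner_sub_left] at h1
      show inner ℝ (F' (x + t • d)) d ≤ inner ℝ (F' x) d + L * t * ‖d‖ ^ 2
      nlinarith)
  have := key (x := 1) (by simp)
  simpa using this

/-- One-step descent inequality for a gradient step with additive error `e`
and learning rate `1/L` (Lemma 1, deterministic form). -/
theorem descent_lemma_with_error
    {E : Type*} [NormedAddCommGroup E] [InnerProductSpace ℝ E] [CompleteSpace E]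
    (F : E → ℝ) (F' : E → E) (L : ℝ) (hL : 0 < L)
    (hdiff : ∀ x, HasGradientAt F (F' x) x)
    (hlip : ∀ x y, ‖F' x - F' y‖ ≤ L * ‖x - y‖)
    (x e : E) :
    F (x - (1 / L) • (F' x - e)) ≤
      F x - (1 / (2 * L)) * ‖F' x‖ ^ 2 + (1 / (2 * L)) * ‖e‖ ^ 2 := by
  have h := quadratic_upper_bound F F' L hdiff hlip x (-((1 / L) • (F' x - e)))
  rw [← sub_eq_add_neg] at h
  refine h.trans (le_of_eq ?_)
  rw [norm_neg, norm_smul, mul_pow, norm_sub_sq_real, inner_neg_right, inner_smul_right,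
    inner_sub_right, real_inner_self_eq_norm_sq, Real.norm_of_nonneg (by positivity)]
  field_simp
  ring
end

section
/- Let E be a real inner product space and F : E → ℝ differentiable with L-Lipschitz gradient (L > 0) and μ-strongly convex (μ > 0), with global minimizer x⋆. Let x, e ∈ E and let g, α₂, β be nonnegative reals with α₂·g ≤ 1. If ‖e‖² ≤ α₂·g·‖∇F(x)‖² + β, then the point x' = x − (1/L)·(∇F(x) − e) satisfies F(x') − F(x⋆) ≤ (1 − (μ/L)·(1 − α₂·g))·(F(x) − F(x⋆)) + β/(2L). -/
open scoped InnerProductSpace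

theorem descent_aux
    {E : Type*} [NormedAddCommGroup E] [InnerProductSpace ℝ E] [CompleteSpace E]
    (F : E → ℝ) (F' : E → E) (L : ℝ)
    (hdiff : ∀ x, HasGradientAt F (F' x) x)
    (hlip : ∀ x y, ‖F' x - F' y‖ ≤ L * ‖x - y‖) (x d : E) :
    F (x + d) ≤ F x + ⟪F' x, d⟫_ℝ + L / 2 * ‖d‖ ^ 2 := by
  have hd : ∀ t : ℝ, HasDerivAt
      (fun t : ℝ => F (x + t • d) - t * ⟪F' x, d⟫_ℝ - L / 2 * ‖d‖ ^ 2 * t ^ 2)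
      (⟪F' (x + t • d), d⟫_ℝ - ⟪F' x, d⟫_ℝ - L * ‖d‖ ^ 2 * t) t := by
    intro t
    have h1 : HasDerivAt (fun t : ℝ => x + t • d) d t := by
      simpa using ((hasDerivAt_id t).smul_const d).const_add x
    have h2 := (hdiff (x + t • d)).hasFDerivAt.comp_hasDerivAt t h1
    have h3 := (hasDerivAt_id t).mul_const ⟪F' x, d⟫_ℝ
    have h4 := ((hasDerivAt_id t).pow 2).const_mul (L / 2 * ‖d‖ ^ 2)
    have h5 := (h2.sub h3).sub h4
    refine HasDerivAt.congr_deriv h5 ?_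
    simp
    ring
  have hanti := antitoneOn_of_deriv_nonpos (convex_Icc (0 : ℝ) 1)
    (fun t _ => (hd t).continuousAt.continuousWithinAt)
    (fun t _ => (hd t).differentiableAt.differentiableWithinAt)
    (by
      intro t ht
      rw [interior_Icc] at ht
      rw [(hd t).deriv, ← inner_sub_left]
      have h1 := real_inner_le_norm (F' (x + t • d) - F' x) d
      have h2 := hlip (x + t • d) x
      rw [add_sub_cancel_left, norm_smul, Real.norm_of_nonneg ht.1.le] at h2
      nlinarith [mul_le_mul_of_nonneg_right h2 (norm_nonneg d)])
  have := hanti (Set.left_mem_Icc.2 zero_le_one) (Set.right_mem_Icc.2 zero_le_one) zero_le_one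
  simp at this
  linarith

/-- Per-iteration contraction inequality (eq. (53) underlying Proposition 2):
a gradient step with additive error `e` whose squared norm is bounded by
`α₂·g·‖∇F(x)‖² + β` contracts the optimality gap. -/
theorem per_iteration_contraction
    {E : Type*} [NormedAddCommGroup E] [InnerProductSpace ℝ E] [CompleteSpace E]
    (F : E → ℝ) (F' : E → E) (L μ : ℝ) (hL : 0 < L) (hμ : 0 < μ)
    (hdiff : ∀ x, HasGradientAt F (F' x) x)
    (hlip : ∀ x y, ‖F' x - F' y‖ ≤ L * ‖x - y‖)
    (hsc : ∀ x y, F x ≥ F y + ⟪F' y, x - y⟫_ℝ + (μ / 2) * ‖x - y‖ ^ 2)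
    (xstar : E) (hmin : ∀ x, F xstar ≤ F x)
    (x e : E) (g α₂ β : ℝ) (hg : 0 ≤ g) (hα₂ : 0 ≤ α₂) (hβ : 0 ≤ β)
    (hsmall : α₂ * g ≤ 1)
    (he : ‖e‖ ^ 2 ≤ α₂ * g * ‖F' x‖ ^ 2 + β) :
    F (x - (1 / L) • (F' x - e)) - F xstar ≤
      (1 - (μ / L) * (1 - α₂ * g)) * (F x - F xstar) + β / (2 * L) := by
  have h1 := descent_aux F F' L hdiff hlip x (-((1 / L) • (F' x - e)))
  rw [← sub_eq_add_neg, norm_neg, inner_neg_right, inner_smul_right, norm_smul, mul_pow,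
    norm_sub_sq_real, inner_sub_right, real_inner_self_eq_norm_sq,
    Real.norm_of_nonneg (by positivity)] at h1
  have h2 : F (x - (1 / L) • (F' x - e)) ≤ F x - ‖F' x‖ ^ 2 / (2 * L) + ‖e‖ ^ 2 / (2 * L) := by
    refine h1.trans (le_of_eq ?_)
    field_simp
    ring
  have h3 : 2 * μ * (F x - F xstar) ≤ ‖F' x‖ ^ 2 := by
    have a := hsc xstar x
    have b := norm_add_sq_real (F' x) (μ • (xstar - x))
    rw [inner_smul_right, norm_smul, mul_pow, Real.norm_of_nonneg hμ.le] at b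
    nlinarith [sq_nonneg ‖F' x + μ • (xstar - x)‖]
  have h4 := mul_le_mul_of_nonneg_left h3 (sub_nonneg.2 hsmall)
  have h5 : (‖e‖ ^ 2 - ‖F' x‖ ^ 2) / (2 * L) ≤
      (β - (1 - α₂ * g) * (2 * μ * (F x - F xstar))) / (2 * L) := by
    gcongr ?_ / _
    linarith
  have h6 : (β - (1 - α₂ * g) * (2 * μ * (F x - F xstar))) / (2 * L) =
      β / (2 * L) - (μ / L) * (1 - α₂ * g) * (F x - F xstar) := by
    field_simp
  rw [sub_div] at h5
  linarith
end
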